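/- Let X be a set with an associative binary operation *. If 𝒜 is a shift-invariant inclusion hyperspace on X and 𝒝 is any inclusion hyperspace on X, then 𝒜 ∘ 𝒝 is shift-invariant. Consequently, if the set ↔G(X) of shift-invariant inclusion hyperspaces on X is nonempty, then ↔G(X) is an ideal of the semigroup of inclusion hyperspaces under ∘ which is contained in every ideal, i.e. ↔G(X) is the minimal ideal. -/

import Mathlib

variable {X : Type*}

/-- An inclusion hyperspace on a set `X`. -/
def IsIH (𝒜 : Set (Set X)) : Prop :=
  𝒜.Nonempty ∧ (∀ A ∈ 𝒜, A.Nonempty) ∧ ∀ A ∈ 𝒜, ∀ B : Set X, A ⊆ B → B ∈ 𝒜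

/-- The operation on inclusion hyperspaces induced by a binary operation on `X`. -/
def circ (op : X → X → X) (𝒰 𝒱 : Set (Set X)) : Set (Set X) :=
  {A | {x | {y | op x y ∈ A} ∈ 𝒱} ∈ 𝒰}

/-- An inclusion hyperspace is shift-invariant if it is closed under left shifts
`x*A` and preimage shifts `x⁻¹A`. -/
def ShiftInv (op : X → X → X) (𝒜 : Set (Set X)) : Prop :=
  ∀ A ∈ 𝒜, ∀ x : X, (op x) '' A ∈ 𝒜 ∧ {y : X | op x y ∈ A} ∈ 𝒜

theorem IsIH.univ_mem {𝒜 : Set (Set X)} (h : IsIH 𝒜) : Set.univ ∈ 𝒜 := by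
  obtain ⟨A, hA⟩ := h.1
  exact h.2.2 A hA _ (Set.subset_univ A)

theorem IsIH.circ {op : X → X → X} {𝒰 𝒱 : Set (Set X)} (hU : IsIH 𝒰) (hV : IsIH 𝒱) :
    IsIH (_root_.circ op 𝒰 𝒱) := by
  refine ⟨⟨Set.univ, ?_⟩, fun A hA => ?_, fun A hA B hAB => ?_⟩
  · refine hU.2.2 _ hU.univ_mem _ fun x _ => ?_
    exact hV.2.2 _ hV.univ_mem _ fun y _ => Set.mem_univ _
  · obtain ⟨x, hx⟩ := hU.2.1 _ hA
    obtain ⟨y, hy⟩ := hV.2.1 _ hx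
    exact ⟨op x y, hy⟩
  · exact hU.2.2 _ hA _ fun x hx => hV.2.2 _ hx _ fun y hy => hAB hy

theorem ShiftInv.circ {op : X → X → X} (hassoc : ∀ x y z : X, op (op x y) z = op x (op y z))
    {𝒰 𝒱 : Set (Set X)} (hU : IsIH 𝒰) (hs : ShiftInv op 𝒰) (hV : IsIH 𝒱) :
    ShiftInv op (_root_.circ op 𝒰 𝒱) := by
  refine fun A hA z => ⟨hU.2.2 _ (hs _ hA z).1 _ ?_, hU.2.2 _ (hs _ hA z).2 _ ?_⟩
  · rintro _ ⟨s, hs, rfl⟩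
    exact hV.2.2 _ hs _ fun y hy => ⟨op s y, hy, (hassoc z s y).symm⟩
  · intro x hx
    refine hV.2.2 _ hx _ fun y hy => ?_
    change op z (op x y) ∈ A
    rw [← hassoc]
    exact hy

/-- Shift-invariant inclusion hyperspaces are right zeros for `circ`. -/
theorem ShiftInv.circ_eq_right {op : X → X → X} {𝒰 𝒱 : Set (Set X)} (hU : IsIH 𝒰)
    (hV : IsIH 𝒱) (hs : ShiftInv op 𝒱) : _root_.circ op 𝒰 𝒱 = 𝒱 := by
  ext A
  constructor
  · intro hA
    obtain ⟨x, hx⟩ := hU.2.1 _ hA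
    exact hV.2.2 _ (hs _ hx x).1 _ (Set.image_subset_iff.2 fun y hy => hy)
  · exact fun hA => hU.2.2 _ hU.univ_mem _ fun x _ => (hs A hA x).2

theorem stmt12 (op : X → X → X)
    (hassoc : ∀ x y z : X, op (op x y) z = op x (op y z)) :
    -- shift-invariance is preserved by right multiplication
    (∀ 𝒜 𝒝 : Set (Set X), IsIH 𝒜 → ShiftInv op 𝒜 → IsIH 𝒝 →
      ShiftInv op (circ op 𝒜 𝒝)) ∧
    -- consequently, if nonempty, the shift-invariant inclusion hyperspaces form
    -- the minimal ideal
    ((∃ 𝒜 : Set (Set X), IsIH 𝒜 ∧ ShiftInv op 𝒜) →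
      (∀ 𝒜 𝒝 : Set (Set X), IsIH 𝒜 → ShiftInv op 𝒜 → IsIH 𝒝 →
        (IsIH (circ op 𝒜 𝒝) ∧ ShiftInv op (circ op 𝒜 𝒝)) ∧
        (IsIH (circ op 𝒝 𝒜) ∧ ShiftInv op (circ op 𝒝 𝒜))) ∧
      (∀ I : Set (Set (Set X)), I.Nonempty → (∀ 𝒜 ∈ I, IsIH 𝒜) →
        (∀ 𝒜 ∈ I, ∀ 𝒝 : Set (Set X), IsIH 𝒝 →
          circ op 𝒜 𝒝 ∈ I ∧ circ op 𝒝 𝒜 ∈ I) →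
        ∀ 𝒞 : Set (Set X), IsIH 𝒞 → ShiftInv op 𝒞 → 𝒞 ∈ I)) := by
  refine ⟨fun 𝒜 𝒝 hA hs hB => hs.circ hassoc hA hB, fun _ => ⟨fun 𝒜 𝒝 hA hs hB => ?_, ?_⟩⟩
  · rw [ShiftInv.circ_eq_right hB hA hs]
    exact ⟨⟨hA.circ hB, hs.circ hassoc hA hB⟩, hA, hs⟩
  · rintro I ⟨𝒜, hA⟩ hI hideal 𝒞 hC hs
    rw [← ShiftInv.circ_eq_right (hI 𝒜 hA) hC hs]
    exact (hideal 𝒜 hA 𝒞 hC).1
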